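/- Let L be a modular lattice of width two with no doubly reducible elements, and let G be a sublattice of L equipped with a lattice isomorphism φ : 2 × 3 → G, where the elements of 2 × 3 are pairs (i, j) with i ∈ {0,1}, j ∈ {0,1,2}. Then for each j ∈ {0,1,2}, the element φ(1, j) covers φ(0, j) in L; that is, there is no w ∈ L with φ(0, j) < w < φ(1, j). -/

import Mathlib

/-- An element `x` of a lattice is doubly reducible if `x = a ⊔ b` for some `a, b < x`
and `x = c ⊓ d` for some `c, d > x`. -/
def DoublyReducible {L : Type*} [Lattice L] (x : L) : Prop :=
  (∃ a b : L, a < x ∧ b < x ∧ a ⊔ b = x) ∧ (∃ c d : L, x < c ∧ x < d ∧ c ⊓ d = x)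

/-- A lattice `L` is linearly indecomposable if there is no partition of `L` into nonempty
sets `A` and `B` with `a < b` for all `a ∈ A` and `b ∈ B`. -/
def LinearlyIndecomposable (L : Type*) [Lattice L] : Prop :=
  ¬ ∃ A B : Set L, A.Nonempty ∧ B.Nonempty ∧ A ∩ B = ∅ ∧ A ∪ B = Set.univ ∧
      ∀ a ∈ A, ∀ b ∈ B, a < b

/-- A lattice has width `n` if every antichain in it has at most `n` elements and some
antichain has exactly `n` elements. -/
def HasWidth (L : Type*) [Lattice L] (n : ℕ) : Prop :=
  (∀ S : Set L, IsAntichain (· ≤ ·) S → S.encard ≤ n) ∧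
  ∃ S : Set L, IsAntichain (· ≤ ·) S ∧ S.encard = n

/-- An order isomorphism onto a subset closed under joins preserves joins in the ambient lattice. -/
theorem coe_orderIso_sup {P L : Type*} [Lattice P] [Lattice L] {G : Set L}
    (hG : ∀ x ∈ G, ∀ y ∈ G, x ⊔ y ∈ G) (φ : P ≃o G) (p q : P) :
    (φ p : L) ⊔ φ q = φ (p ⊔ q) := by
  apply le_antisymm
  · exact sup_le (φ.monotone le_sup_left) (φ.monotone le_sup_right)
  · let g : G := ⟨(φ p : L) ⊔ φ q, hG _ (φ p).2 _ (φ q).2⟩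
    have h : p ⊔ q ≤ φ.symm g :=
      sup_le (φ.le_symm_apply.2 (le_sup_left : (φ p : L) ≤ _))
        (φ.le_symm_apply.2 (le_sup_right : (φ q : L) ≤ _))
    exact φ.le_symm_apply.1 h

/-- An order isomorphism onto a subset closed under meets preserves meets in the ambient lattice. -/
theorem coe_orderIso_inf {P L : Type*} [Lattice P] [Lattice L] {G : Set L}
    (hG : ∀ x ∈ G, ∀ y ∈ G, x ⊓ y ∈ G) (φ : P ≃o G) (p q : P) :
    (φ p : L) ⊓ φ q = φ (p ⊓ q) := by
  apply le_antisymm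
  · let g : G := ⟨(φ p : L) ⊓ φ q, hG _ (φ p).2 _ (φ q).2⟩
    have h : φ.symm g ≤ p ⊓ q :=
      le_inf (φ.symm_apply_le.2 (inf_le_left : _ ≤ (φ p : L)))
        (φ.symm_apply_le.2 (inf_le_right : _ ≤ (φ q : L)))
    exact φ.symm_apply_le.1 h
  · exact le_inf (φ.monotone inf_le_left) (φ.monotone inf_le_right)

/-- In a modular lattice, an element strictly inside the middle rung `(a₁, b₁)` of a copy of
`2 × 3` is doubly reducible. -/
theorem doublyReducible_of_mem_middle_rung {L : Type*} [Lattice L] [IsModularLattice L]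
    {a₁ a₂ b₀ b₁ w : L} (hsup : b₀ ⊔ a₁ = b₁) (hinf : b₁ ⊓ a₂ = a₁)
    (hb : ¬ a₁ ≤ b₀) (ha : ¬ a₂ ≤ b₁) (haw : a₁ < w) (hwb : w < b₁) :
    DoublyReducible w := by
  refine ⟨⟨w ⊓ b₀, a₁, inf_lt_left.2 fun h => hb (haw.le.trans h), haw, ?_⟩,
    ⟨w ⊔ a₂, b₁, left_lt_sup.2 fun h => ha (h.trans hwb.le), hwb, ?_⟩⟩
  · rw [inf_sup_assoc_of_le b₀ haw.le, hsup, inf_eq_left.2 hwb.le]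
  · rw [sup_inf_assoc_of_le a₂ hwb.le, inf_comm, hinf, sup_eq_left.2 haw.le]

/-- Let `L` be a modular lattice of width two with no doubly reducible elements, and let `G` be a
sublattice of `L` equipped with a lattice isomorphism `φ : 2 × 3 → G`. Then for each
`j ∈ {0, 1, 2}`, the element `φ (1, j)` covers `φ (0, j)` in `L`: there is no `w ∈ L` with
`φ (0, j) < w < φ (1, j)`. -/
theorem statement10 (L : Type*) [Lattice L]
    (hmod : ∀ a b c : L, a ≤ c → a ⊔ (b ⊓ c) = (a ⊔ b) ⊓ c)
    (hw : HasWidth L 2)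
    (hdr : ∀ x : L, ¬ DoublyReducible x)
    (G : Set L) (hG : ∀ x ∈ G, ∀ y ∈ G, x ⊔ y ∈ G ∧ x ⊓ y ∈ G)
    (φ : (Fin 2 × Fin 3) ≃o G) :
    ∀ j : Fin 3, ((φ (0, j) : L) < (φ (1, j) : L)) ∧
      ¬ ∃ w : L, (φ (0, j) : L) < w ∧ w < (φ (1, j) : L) := by
  have hsup (p q) := coe_orderIso_sup (fun x hx y hy => (hG x hx y hy).1) φ p q
  have hinf (p q) := coe_orderIso_inf (fun x hx y hy => (hG x hx y hy).2) φ p q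
  have hle {p q} : (φ p : L) ≤ φ q ↔ p ≤ q := φ.le_iff_le
  have hlt {p q} : (φ p : L) < φ q ↔ p < q := φ.lt_iff_lt
  have : IsModularLattice L := ⟨fun {a} b {c} h => (hmod a b c h).ge⟩
  have middle (w : L) (haw : (φ (0, 1) : L) < w) (hwb : w < φ (1, 1)) : False :=
    hdr w (doublyReducible_of_mem_middle_rung (hsup (1, 0) (0, 1)) (hinf (1, 1) (0, 2))
      (hle.not.2 (by decide)) (hle.not.2 (by decide)) haw hwb)
  intro j
  refine ⟨hlt.2 (Prod.mk_lt_mk_iff_left.2 (by decide)), ?_⟩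
  rintro ⟨w, haw, hwb⟩
  fin_cases j
  · change (φ (0, 0) : L) < w at haw
    change w < (φ (1, 0) : L) at hwb
    have h01 : (φ (0, 1) : L) ⊓ φ (1, 0) = φ (0, 0) := hinf _ _
    refine middle (w ⊔ φ (0, 1)) (right_lt_sup.2 fun h => ?_) (lt_of_le_of_ne ?_ fun h => ?_)
    · exact haw.not_ge (h01 ▸ le_inf h hwb.le)
    · exact sup_le (hwb.le.trans (hle.2 (by decide))) (hle.2 (by decide))
    · have key := sup_inf_assoc_of_le (φ (0, 1) : L) hwb.le
      rw [h, h01, sup_eq_left.2 haw.le, inf_eq_right.2 (hle.2 (by decide))] at key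
      exact hwb.ne key.symm
  · exact middle w haw hwb
  · change (φ (0, 2) : L) < w at haw
    change w < (φ (1, 2) : L) at hwb
    have h12 : (φ (1, 1) : L) ⊔ φ (0, 2) = φ (1, 2) := hsup _ _
    refine middle (w ⊓ φ (1, 1)) (lt_of_le_of_ne ?_ fun h => ?_) (inf_lt_right.2 fun h => ?_)
    · exact le_inf ((hle.2 (by decide)).trans haw.le) (hle.2 (by decide))
    · have key := inf_sup_assoc_of_le (φ (1, 1) : L) haw.le
      rw [← h, h12, inf_eq_left.2 hwb.le, sup_eq_right.2 (hle.2 (by decide))] at key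
      exact haw.ne key
    · exact hwb.not_ge (h12 ▸ sup_le h haw.le)
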